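/- For every integer q and every real s with 1 < s ≤ q, let α be a solution to OPT_q(s) such that SUPP_q(α) can be obtained from a complete graph by removing the edges of a star with at least one edge (a nonempty collection of edges sharing a common endpoint). Then the star has exactly two edges, and SUPP_q(α) belongs to the class Q; that is, the support of α consists of a partition A_1,…,A_k of [q] into k nonempty sets together with the set A_1 ∪ A_2, for some k. -/

import Mathlib

/-- The nonempty subsets of `[q] = Fin q`, indexing the coordinates of our vectors. -/
def NEsets (q : ℕ) : Finset (Finset (Fin q)) :=
  Finset.univ.filter (fun A => A.Nonempty)

/-- The objective function `OBJ_q(α) = Σ_{A ≠ ∅} α_A log |A|`. -/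
noncomputable def objQ (q : ℕ) (α : Finset (Fin q) → ℝ) : ℝ :=
  ∑ A ∈ NEsets q, α A * Real.log (A.card : ℝ)

/-- The constraint function `V_q(α) = Σ_{A ≠ ∅} α_A`. -/
noncomputable def vQ (q : ℕ) (α : Finset (Fin q) → ℝ) : ℝ :=
  ∑ A ∈ NEsets q, α A

/-- The constraint function `E_q(α) = Σ_{{A,B} : A ∩ B = ∅} α_A α_B`, the sum being
over unordered pairs of disjoint nonempty sets. -/
noncomputable def eQ (q : ℕ) (α : Finset (Fin q) → ℝ) : ℝ :=
  (1 / 2) * ∑ A ∈ NEsets q, ∑ B ∈ NEsets q,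
    if Disjoint A B then α A * α B else 0

/-- The feasible set `FEAS_q(s)`: nonnegative vectors (indexed by nonempty subsets of
`[q]`, so the coordinate at `∅` is normalized to `0`) with `V_q(α) = 1` and
`E_q(α) ≥ (s-1)/(2s)`. -/
def Feas (q : ℕ) (s : ℝ) (α : Finset (Fin q) → ℝ) : Prop :=
  α ∅ = 0 ∧ (∀ A, 0 ≤ α A) ∧ vQ q α = 1 ∧ (s - 1) / (2 * s) ≤ eQ q α

/-- `α` is a solution to `OPT_q(s)`: it is feasible and maximizes `OBJ_q` over
`FEAS_q(s)`. -/
def IsSolution (q : ℕ) (s : ℝ) (α : Finset (Fin q) → ℝ) : Prop :=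
  Feas q s α ∧ ∀ β, Feas q s β → objQ q β ≤ objQ q α

/-- The support of `α`: the nonempty sets `A ⊆ [q]` with `α_A > 0`. -/
noncomputable def supp (q : ℕ) (α : Finset (Fin q) → ℝ) : Finset (Finset (Fin q)) :=
  @Finset.filter _ (fun A => 0 < α A) (Classical.decPred _) (NEsets q)

/-- `P` is a partition of `[q]` into nonempty parts. -/
def IsPartitionOf (q : ℕ) (P : Finset (Finset (Fin q))) : Prop :=
  (∀ A ∈ P, A.Nonempty) ∧ (∀ A ∈ P, ∀ B ∈ P, A ≠ B → Disjoint A B) ∧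
    P.biUnion id = Finset.univ

/-- `SUPP_q(α)` is in class `P_k`: the support of `α` is a partition of `[q]`
into `k` nonempty sets. -/
def ClassP (q k : ℕ) (α : Finset (Fin q) → ℝ) : Prop :=
  IsPartitionOf q (supp q α) ∧ (supp q α).card = k

/-- `SUPP_q(α)` is in class `Q_k`: the support of `α` consists of a partition
`A₁, …, A_k` of `[q]` into `k` nonempty sets together with the set `A₁ ∪ A₂`. -/
def ClassQ (q k : ℕ) (α : Finset (Fin q) → ℝ) : Prop :=
  ∃ P : Finset (Finset (Fin q)), ∃ A₁ ∈ P, ∃ A₂ ∈ P, A₁ ≠ A₂ ∧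
    IsPartitionOf q P ∧ P.card = k ∧ supp q α = insert (A₁ ∪ A₂) P

open Filter Topology

/-- The total `α`-weight of the nonempty sets disjoint from `A`. -/
noncomputable def disjointWeight (q : ℕ) (α : Finset (Fin q) → ℝ) (A : Finset (Fin q)) : ℝ :=
  ∑ B ∈ NEsets q, if Disjoint A B then α B else 0

lemma mem_NEsets {q : ℕ} {A : Finset (Fin q)} : A ∈ NEsets q ↔ A.Nonempty := by
  simp [NEsets]

lemma mem_supp {q : ℕ} {α : Finset (Fin q) → ℝ} {A : Finset (Fin q)} :
    A ∈ supp q α ↔ A.Nonempty ∧ 0 < α A := by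
  simp [supp, NEsets]

/-- Second-order expansion of the quadratic form `eQ` along a line. -/
lemma eQ_add_mul (q : ℕ) (α v : Finset (Fin q) → ℝ) (t : ℝ) :
    eQ q (fun A => α A + t * v A) =
      eQ q α + t * (∑ A ∈ NEsets q, v A * disjointWeight q α A) + t ^ 2 * eQ q v := by
  have h1 : ∑ A ∈ NEsets q, v A * disjointWeight q α A =
      ∑ A ∈ NEsets q, ∑ B ∈ NEsets q, if Disjoint A B then v A * α B else 0 := by
    simp only [disjointWeight, Finset.mul_sum, mul_ite, mul_zero]
  have h2 : ∑ A ∈ NEsets q, v A * disjointWeight q α A =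
      ∑ A ∈ NEsets q, ∑ B ∈ NEsets q, if Disjoint A B then α A * v B else 0 := by
    rw [h1, Finset.sum_comm]
    refine Finset.sum_congr rfl fun A _ => Finset.sum_congr rfl fun B _ => ?_
    simp only [disjoint_comm (a := B), mul_comm (v B)]
  have h3 : ∑ A ∈ NEsets q, v A * disjointWeight q α A = (1 / 2) *
      ((∑ A ∈ NEsets q, ∑ B ∈ NEsets q, if Disjoint A B then v A * α B else 0) +
        ∑ A ∈ NEsets q, ∑ B ∈ NEsets q, if Disjoint A B then α A * v B else 0) := by
    rw [← h1, ← h2]; ring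
  rw [h3]
  simp only [eQ, Finset.mul_sum, ← Finset.sum_add_distrib]
  refine Finset.sum_congr rfl fun A _ => Finset.sum_congr rfl fun B _ => ?_
  split_ifs <;> ring

/-- A direction that preserves feasibility for small positive times cannot increase the
objective at a solution. -/
lemma IsSolution.objQ_nonpos_of_eventually {q : ℕ} {s : ℝ} {α : Finset (Fin q) → ℝ}
    (hα : IsSolution q s α) {v : Finset (Fin q) → ℝ} (hv0 : v ∅ = 0)
    (hv : ∀ A, α A = 0 → 0 ≤ v A) (hsum : vQ q v = 0)
    (hE : ∀ᶠ t in 𝓝[>] (0 : ℝ), 0 ≤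
      t * (∑ A ∈ NEsets q, v A * disjointWeight q α A) + t ^ 2 * eQ q v) :
    objQ q v ≤ 0 := by
  obtain ⟨⟨h0, hnn, hV, hEα⟩, hmax⟩ := hα
  have hpos : ∀ᶠ t in 𝓝[>] (0 : ℝ), ∀ A, 0 ≤ α A + t * v A := by
    rw [eventually_all]
    intro A
    rcases (hnn A).eq_or_lt with h | h
    · filter_upwards [self_mem_nhdsWithin] with t ht
      rw [← h, zero_add]
      exact mul_nonneg (le_of_lt ht) (hv A h.symm)
    · have hc : Tendsto (fun t : ℝ => α A + t * v A) (𝓝[>] 0) (𝓝 (α A + 0 * v A)) :=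
        (Continuous.tendsto (by fun_prop) 0).mono_left nhdsWithin_le_nhds
      rw [zero_mul, add_zero] at hc
      exact (hc.eventually (lt_mem_nhds h)).mono fun _ ht => le_of_lt ht
  obtain ⟨t, hp, hE, ht⟩ := (hpos.and (hE.and self_mem_nhdsWithin)).exists
  have ht : 0 < t := ht
  have hobj := hmax (fun A => α A + t * v A) ⟨by simp [h0, hv0], hp, by
    simp only [vQ, Finset.sum_add_distrib, ← Finset.mul_sum] at hV hsum ⊢
    rw [hV, hsum]; ring, by rw [eQ_add_mul]; linarith⟩
  have hlin : objQ q (fun A => α A + t * v A) = objQ q α + t * objQ q v := by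
    simp only [objQ, Finset.mul_sum, ← Finset.sum_add_distrib]
    exact Finset.sum_congr rfl fun A _ => by ring
  rw [hlin] at hobj
  by_contra! hc
  have := mul_pos ht hc
  linarith

/-- A direction along which `eQ` increases to first order cannot increase the objective. -/
lemma IsSolution.objQ_nonpos_of_pos {q : ℕ} {s : ℝ} {α : Finset (Fin q) → ℝ}
    (hα : IsSolution q s α) {v : Finset (Fin q) → ℝ} (hv0 : v ∅ = 0)
    (hv : ∀ A, α A = 0 → 0 ≤ v A) (hsum : vQ q v = 0)
    (hd : 0 < ∑ A ∈ NEsets q, v A * disjointWeight q α A) : objQ q v ≤ 0 := by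
  refine hα.objQ_nonpos_of_eventually hv0 hv hsum ?_
  set D := ∑ A ∈ NEsets q, v A * disjointWeight q α A
  have hc : Tendsto (fun t : ℝ => D + t * eQ q v) (𝓝[>] 0) (𝓝 (D + 0 * eQ q v)) :=
    (Continuous.tendsto (by fun_prop) 0).mono_left nhdsWithin_le_nhds
  rw [zero_mul, add_zero] at hc
  filter_upwards [hc.eventually (lt_mem_nhds hd), self_mem_nhdsWithin] with t h1 h2
  have h2 : 0 < t := h2
  nlinarith [mul_pos h2 h1]

lemma sum_single_mul {q : ℕ} {B : Finset (Fin q)} (hB : B.Nonempty)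
    (f : Finset (Fin q) → ℝ) :
    ∑ A ∈ NEsets q, (Pi.single B 1 : Finset (Fin q) → ℝ) A * f A = f B := by
  rw [Finset.sum_eq_single B]
  · simp
  · intro A _ h
    simp [h]
  · intro h
    exact absurd (mem_NEsets.2 hB) h

/-- First-order optimality with the multiplier eliminated by means of two support sets
`L` and `C` whose disjoint weights differ. -/
lemma IsSolution.exchange {q : ℕ} {s : ℝ} {α : Finset (Fin q) → ℝ}
    (hα : IsSolution q s α) {L C A B : Finset (Fin q)} (hL : L ∈ supp q α)
    (hC : C ∈ supp q α) (hA : A ∈ supp q α) (hB : B.Nonempty)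
    (hLC : disjointWeight q α C < disjointWeight q α L) :
    Real.log B.card - Real.log A.card ≤
      (Real.log C.card - Real.log L.card) / (disjointWeight q α L - disjointWeight q α C) *
        (disjointWeight q α A - disjointWeight q α B) := by
  obtain ⟨hLn, hLp⟩ := mem_supp.1 hL
  obtain ⟨hCn, hCp⟩ := mem_supp.1 hC
  obtain ⟨hAn, hAp⟩ := mem_supp.1 hA
  set g := disjointWeight q α L - disjointWeight q α C with hg
  have hgpos : 0 < g := sub_pos.2 hLC
  set r := (disjointWeight q α A - disjointWeight q α B) / g with hr
  have hrg : r * g = disjointWeight q α A - disjointWeight q α B := by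
    rw [hr]; field_simp
  have key : ∀ u, r < u → u * (Real.log L.card - Real.log C.card) +
      (Real.log B.card - Real.log A.card) ≤ 0 := by
    intro u hu
    let v : Finset (Fin q) → ℝ := fun X =>
      u * ((Pi.single L 1 : Finset (Fin q) → ℝ) X - (Pi.single C 1 : Finset (Fin q) → ℝ) X) +
        ((Pi.single B 1 : Finset (Fin q) → ℝ) X - (Pi.single A 1 : Finset (Fin q) → ℝ) X)
    have hlin : ∀ f : Finset (Fin q) → ℝ, ∑ X ∈ NEsets q, v X * f X =
        u * (f L - f C) + (f B - f A) := by
      intro f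
      simp only [v, add_mul, sub_mul, mul_assoc, Finset.sum_add_distrib,
        Finset.sum_sub_distrib, ← Finset.mul_sum, sum_single_mul hLn, sum_single_mul hCn,
        sum_single_mul hAn, sum_single_mul hB]
    have h := hα.objQ_nonpos_of_pos (v := v) ?_ ?_ ?_ ?_
    · rwa [objQ, hlin] at h
    · simp [v, hLn.ne_empty.symm, hCn.ne_empty.symm, hAn.ne_empty.symm, hB.ne_empty.symm]
    · intro X hX
      have h1 : X ≠ L := by rintro rfl; exact hLp.ne' hX
      have h2 : X ≠ C := by rintro rfl; exact hCp.ne' hX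
      have h3 : X ≠ A := by rintro rfl; exact hAp.ne' hX
      simp only [v, Pi.single_apply, h1, h2, h3, if_false]
      split_ifs <;> norm_num
    · simpa [vQ] using hlin fun _ => 1
    · rw [hlin]
      nlinarith [mul_lt_mul_of_pos_right hu hgpos]
  have hlim : r * (Real.log L.card - Real.log C.card) +
      (Real.log B.card - Real.log A.card) ≤ 0 := by
    have hc : Tendsto (fun u : ℝ => u * (Real.log L.card - Real.log C.card) +
        (Real.log B.card - Real.log A.card)) (𝓝[>] r)
        (𝓝 (r * (Real.log L.card - Real.log C.card) +
          (Real.log B.card - Real.log A.card))) :=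
      (Continuous.tendsto (by fun_prop) r).mono_left nhdsWithin_le_nhds
    refine le_of_tendsto hc ?_
    filter_upwards [self_mem_nhdsWithin] with u hu using key u hu
  have : (Real.log C.card - Real.log L.card) / g *
      (disjointWeight q α A - disjointWeight q α B) =
        -(r * (Real.log L.card - Real.log C.card)) := by
    rw [hr]; ring
  linarith

/-- A support set of a solution cannot be enlarged while staying disjoint from all the
support sets that it was disjoint from. -/
lemma IsSolution.not_ssubset {q : ℕ} {s : ℝ} {α : Finset (Fin q) → ℝ}
    (hα : IsSolution q s α) {A B : Finset (Fin q)} (hA : A ∈ supp q α)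
    (hdisj : ∀ D ∈ supp q α, Disjoint A D → Disjoint B D) : ¬ A ⊂ B := by
  intro hAB
  obtain ⟨hAn, hAp⟩ := mem_supp.1 hA
  have hBn : B.Nonempty := hAn.mono hAB.1
  let v : Finset (Fin q) → ℝ := fun X =>
    (Pi.single B 1 : Finset (Fin q) → ℝ) X - (Pi.single A 1 : Finset (Fin q) → ℝ) X
  have hlin : ∀ f : Finset (Fin q) → ℝ, ∑ X ∈ NEsets q, v X * f X = f B - f A := by
    intro f
    simp only [v, sub_mul, Finset.sum_sub_distrib, sum_single_mul hAn, sum_single_mul hBn]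
  have hd : disjointWeight q α A ≤ disjointWeight q α B := by
    refine Finset.sum_le_sum fun D hD => ?_
    have hDnn := hα.1.2.1 D
    rcases hDnn.eq_or_lt with h | h
    · simp [← h]
    · have := hdisj D (mem_supp.2 ⟨mem_NEsets.1 hD, h⟩)
      split_ifs <;> simp_all
  have hmeet : ∀ X, v X ≠ 0 → A ⊆ X := by
    intro X hX
    by_cases h1 : X = B
    · exact h1 ▸ hAB.1
    · by_cases h2 : X = A
      · exact h2 ▸ subset_rfl
      · simp [v, h1, h2, Pi.single_apply] at hX
  have hEv : eQ q v = 0 := by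
    rw [eQ, Finset.sum_eq_zero, mul_zero]
    refine fun X _ => Finset.sum_eq_zero fun Y _ => ?_
    split_ifs with hXY
    · by_contra! hne
      obtain ⟨x, hx⟩ := hAn
      exact Finset.disjoint_left.1 hXY (hmeet X (left_ne_zero_of_mul hne) hx)
        (hmeet Y (right_ne_zero_of_mul hne) hx)
    · rfl
  have h := hα.objQ_nonpos_of_eventually (v := v) ?_ ?_ ?_ ?_
  · rw [objQ, hlin] at h
    have hlt : Real.log A.card < Real.log B.card :=
      Real.log_lt_log (by exact_mod_cast hAn.card_pos)
        (by exact_mod_cast Finset.card_lt_card hAB)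
    linarith
  · simp [v, hAn.ne_empty.symm, hBn.ne_empty.symm]
  · intro X hX
    have h3 : X ≠ A := by rintro rfl; exact hAp.ne' hX
    simp only [v, Pi.single_apply, h3, if_false]
    split_ifs <;> norm_num
  · simpa [vQ] using hlin fun _ => 1
  · filter_upwards [self_mem_nhdsWithin] with t ht
    have ht : 0 < t := ht
    rw [hlin, hEv]
    nlinarith [mul_nonneg ht.le (sub_nonneg.2 hd)]

/-- The disjoint weight is determined by the support. -/
lemma disjointWeight_eq_sum_supp {q : ℕ} {α : Finset (Fin q) → ℝ} (hα : ∀ A, 0 ≤ α A)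
    (B : Finset (Fin q)) :
    disjointWeight q α B = ∑ D ∈ supp q α, if Disjoint B D then α D else 0 := by
  refine (Finset.sum_subset (fun D hD => mem_NEsets.2 (mem_supp.1 hD).1) ?_).symm
  intro D hD hDs
  have : α D = 0 := by
    by_contra hne
    exact hDs (mem_supp.2 ⟨mem_NEsets.1 hD, (hα D).lt_of_ne' hne⟩)
  simp [this]

/-- The numerical incompatibility of the optimality conditions for a star whose leaves `i`, `k`
have sizes `l`, `m` and weights `x`, `y`, where the center has size `n` and the leaves have
total weight `X > x + y`. -/
lemma star_optimality_false {l m n x y X μ : ℝ} (hl : 0 < l) (hm : 0 < m) (hmn : m < n)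
    (hμ : 0 < μ) (hX : x + y < X)
    (h1 : Real.log n - Real.log l = μ * (X - x)) (h2 : Real.log n - Real.log m = μ * (X - y))
    (h3 : Real.log (l + m) - Real.log n ≤ -(μ * (X - x - y)))
    (h4 : Real.log (n - m) - Real.log n ≤ -(μ * y)) : False := by
  have hn : 0 < n := hm.trans hmn
  have hexp : ∀ {z e : ℝ}, 0 < z → Real.log z - Real.log n ≤ e → z ≤ n * Real.exp e := by
    intro z e hz h
    have : Real.log z ≤ Real.log n + e := by linarith
    rw [Real.log_le_iff_le_exp hz, Real.exp_add, Real.exp_log hn] at this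
    exact this
  have hexp' : ∀ {z e : ℝ}, 0 < z → Real.log n - Real.log z = e → z = n * Real.exp (-e) := by
    intro z e hz h
    have : Real.log z = Real.log n + -e := by linarith
    rw [← Real.exp_log hz, this, Real.exp_add, Real.exp_log hn]
  have e1 := hexp' hl h1
  have e2 := hexp' hm h2
  have e3 := hexp (by linarith) h3
  have e4 := hexp (by linarith) h4
  set a := Real.exp (-(μ * x)) with ha
  set b := Real.exp (-(μ * y)) with hb
  have hab : a + b ≤ 1 := by
    have f1 : Real.exp (-(μ * (X - x))) = Real.exp (-(μ * (X - x - y))) * b := by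
      rw [hb, ← Real.exp_add]; ring_nf
    have f2 : Real.exp (-(μ * (X - y))) = Real.exp (-(μ * (X - x - y))) * a := by
      rw [ha, ← Real.exp_add]; ring_nf
    rw [e1, e2, f1, f2] at e3
    have hpos := mul_pos hn (Real.exp_pos (-(μ * (X - x - y))))
    refine le_of_mul_le_mul_left ?_ hpos
    linarith
  have hlt : Real.exp (-(μ * (X - y))) < a := by
    rw [ha, Real.exp_lt_exp]
    nlinarith [mul_pos hμ (sub_pos.2 hX)]
  nlinarith [mul_lt_mul_of_pos_left hlt hn, mul_le_mul_of_nonneg_left hab hn.le]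

/-- Suppose `α` solves `OPT_q(s)` and its support graph is a complete graph minus the
edges of a star with at least one edge: the non-adjacent (i.e. intersecting) pairs of
distinct support sets are exactly the pairs consisting of `center` and a member of
`leaves`. Then the star has exactly two edges and `SUPP_q(α)` is in class `Q`. -/
theorem clique_minus_star (q : ℕ) (s : ℝ) (hs : 1 < s) (hsq : s ≤ q)
    (α : Finset (Fin q) → ℝ) (hα : IsSolution q s α)
    (center : Finset (Fin q)) (leaves : Finset (Finset (Fin q)))
    (hc : center ∈ supp q α) (hl : leaves ⊆ supp q α) (hcl : center ∉ leaves)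
    (hne : leaves.Nonempty)
    (hstar : ∀ A ∈ supp q α, ∀ B ∈ supp q α, A ≠ B →
      (¬ Disjoint A B ↔ ((A = center ∧ B ∈ leaves) ∨ (B = center ∧ A ∈ leaves)))) :
    leaves.card = 2 ∧ ∃ k : ℕ, ClassQ q k α := by
  classical
  have hαnn : ∀ A, 0 ≤ α A := hα.1.2.1
  have hself : ∀ A ∈ supp q α, ¬ Disjoint A A := fun A hA h =>
    (mem_supp.1 hA).1.ne_empty (Finset.disjoint_self_iff_empty A |>.1 h)
  have hmeet : ∀ L ∈ leaves, ¬ Disjoint center L := fun L hL =>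
    (hstar center hc L (hl hL) (by rintro rfl; exact hcl hL)).2 (Or.inl ⟨rfl, hL⟩)
  have hdisj : ∀ A ∈ supp q α, ∀ B ∈ supp q α, A ≠ B → A ≠ center → B ≠ center →
      Disjoint A B := by
    intro A hA B hB hAB hAc hBc
    by_contra h
    rcases (hstar A hA B hB hAB).1 h with h | h
    · exact hAc h.1
    · exact hBc h.1
  have hleaf_ne : ∀ L ∈ leaves, L ≠ center := by rintro L hL rfl; exact hcl hL
  have hmem_leaves : ∀ D ∈ supp q α, D ≠ center → ¬ Disjoint center D → D ∈ leaves := by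
    intro D hD hDc h
    rcases (hstar center hc D hD hDc.symm).1 h with h | h
    · exact h.2
    · exact absurd h.1 hDc
  have hsub : ∀ L ∈ leaves, L ⊆ center := by
    intro L hL
    by_contra hn
    refine hα.not_ssubset (B := center ∪ L) hc ?_ ?_
    · intro D hD hcD
      have hDc : D ≠ center := by rintro rfl; exact hself _ hc hcD
      have hDL : L ≠ D := by rintro rfl; exact hmeet _ hL hcD
      exact Finset.disjoint_union_left.2
        ⟨hcD, hdisj L (hl hL) D hD hDL (hleaf_ne L hL) hDc⟩
    · refine Finset.ssubset_iff_subset_ne.2 ⟨Finset.subset_union_left, fun h => hn ?_⟩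
      rw [h]; exact Finset.subset_union_right
  have hcenter : ∀ x ∈ center, ∃ L ∈ leaves, x ∈ L := by
    intro x hx
    by_contra! hno
    obtain ⟨L, hL⟩ := hne
    refine hα.not_ssubset (B := insert x L) (hl hL) ?_ (Finset.ssubset_insert (hno L hL))
    intro D hD hLD
    refine Finset.disjoint_insert_left.2 ⟨fun hxD => ?_, hLD⟩
    have hDc : D ≠ center := by rintro rfl; exact hmeet L hL hLD.symm
    exact hno D (hmem_leaves D hD hDc fun h => Finset.disjoint_left.1 h hx hxD) hxD
  have hcover : ∀ x, ∃ D ∈ supp q α, x ∈ D := by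
    intro x
    by_contra! hno
    refine hα.not_ssubset (B := insert x center) hc ?_ (Finset.ssubset_insert (hno _ hc))
    intro D hD hcD
    exact Finset.disjoint_insert_left.2 ⟨hno D hD, hcD⟩
  have hcard_ne_one : leaves.card ≠ 1 := by
    intro h
    obtain ⟨L, rfl⟩ := Finset.card_eq_one.1 h
    refine hleaf_ne L (by simp) (Finset.Subset.antisymm (hsub L (by simp)) fun x hx => ?_)
    obtain ⟨L', hL', hx⟩ := hcenter x hx
    rw [Finset.mem_singleton] at hL'
    exact hL' ▸ hx
  have hcard_le : leaves.card ≤ 2 := by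
    by_contra! h3
    obtain ⟨K, L, M, hK, hL, hM, hKL, hKM, hLM⟩ := Finset.two_lt_card_iff.1 h3
    have hleaves_disj : ∀ A ∈ leaves, ∀ B ∈ leaves, A ≠ B → Disjoint A B :=
      fun A hA B hB hAB =>
        hdisj A (hl hA) B (hl hB) hAB (hleaf_ne A hA) (hleaf_ne B hB)
    have hnonempty : ∀ A ∈ leaves, A.Nonempty := fun A hA => (mem_supp.1 (hl hA)).1
    obtain ⟨Y, hY⟩ : ∃ Y : ℝ, ∀ B, B.Nonempty → B ⊆ center → disjointWeight q α B =
        Y + ∑ D ∈ leaves with Disjoint B D, α D := by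
      refine ⟨∑ D ∈ supp q α \ leaves, if Disjoint center D then α D else 0,
        fun B hB hBc => ?_⟩
      rw [disjointWeight_eq_sum_supp hαnn, ← Finset.sum_sdiff hl, Finset.sum_filter]
      congr 1
      refine Finset.sum_congr rfl fun D hD => ?_
      rw [Finset.mem_sdiff] at hD
      by_cases hDc : D = center
      · subst hDc
        have : ¬ Disjoint B D := fun h =>
          hB.ne_empty (Finset.disjoint_self_iff_empty B |>.1 (h.mono_right hBc))
        rw [if_neg this, if_neg (hself D hc)]
      · have hcD : Disjoint center D := by
          by_contra h
          exact hD.2 (hmem_leaves D hD.1 hDc h)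
        simp [hcD, hcD.mono_left hBc]
    have hpos : ∀ A ∈ leaves, 0 < α A := fun A hA => (mem_supp.1 (hl hA)).2
    set X := ∑ D ∈ leaves, α D with hX
    have hdC : disjointWeight q α center = Y := by
      rw [hY center (mem_supp.1 hc).1 subset_rfl, Finset.filter_false_of_mem hmeet]
      simp
    have hdleaf : ∀ A ∈ leaves, disjointWeight q α A = Y + (X - α A) := by
      intro A hA
      rw [hY A (hnonempty A hA) (hsub A hA), hX, ← Finset.sum_erase_eq_sub hA]
      congr 2
      ext D
      simp only [Finset.mem_filter, Finset.mem_erase]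
      constructor
      · rintro ⟨hD, h⟩
        exact ⟨by rintro rfl; exact hself _ (hl hD) h, hD⟩
      · rintro ⟨h, hD⟩
        exact ⟨hD, hleaves_disj A hA D hD h.symm⟩
    have hdunion : disjointWeight q α (K ∪ L) = Y + (X - α K - α L) := by
      rw [hY _ ((hnonempty K hK).mono Finset.subset_union_left)
        (Finset.union_subset (hsub K hK) (hsub L hL)), hX, ← Finset.sum_erase_eq_sub hK,
        ← Finset.sum_erase_eq_sub (Finset.mem_erase.2 ⟨hKL.symm, hL⟩)]
      congr 2
      ext D
      simp only [Finset.mem_filter, Finset.mem_erase, Finset.disjoint_union_left]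
      constructor
      · rintro ⟨hD, h, h'⟩
        exact ⟨by rintro rfl; exact hself _ (hl hD) h',
          by rintro rfl; exact hself _ (hl hD) h, hD⟩
      · rintro ⟨h, h', hD⟩
        exact ⟨hD, hleaves_disj K hK D hD h'.symm, hleaves_disj L hL D hD h.symm⟩
    have hMsub : M ⊆ center \ L := Finset.subset_sdiff.2
      ⟨hsub M hM, hleaves_disj M hM L hL hLM.symm⟩
    have hdsdiff : disjointWeight q α (center \ L) = Y + α L := by
      rw [hY _ ((hnonempty M hM).mono hMsub) Finset.sdiff_subset]
      congr 1
      rw [← Finset.sum_singleton α L]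
      congr 1
      ext D
      simp only [Finset.mem_filter, Finset.mem_singleton]
      constructor
      · rintro ⟨hD, h⟩
        by_contra hDL
        have hDsub : D ⊆ center \ L := Finset.subset_sdiff.2
          ⟨hsub D hD, hleaves_disj D hD L hL hDL⟩
        exact hself D (hl hD) (h.mono_left hDsub)
      · rintro rfl
        exact ⟨hL, Finset.sdiff_disjoint⟩
    have hXlt : α K + α L < X := by
      have hsum : ∑ D ∈ ({K, L, M} : Finset (Finset (Fin q))), α D ≤ X :=
        Finset.sum_le_sum_of_subset_of_nonneg
          (by simp [Finset.insert_subset_iff, hK, hL, hM]) fun D _ _ => hαnn D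
      rw [Finset.sum_insert (by simp [hKL, hKM]), Finset.sum_pair hLM] at hsum
      linarith [hpos M hM]
    have hKlt : K.card < center.card := Finset.card_lt_card
      (Finset.ssubset_iff_subset_ne.2 ⟨hsub K hK, hleaf_ne K hK⟩)
    have hLlt : L.card < center.card := Finset.card_lt_card
      (Finset.ssubset_iff_subset_ne.2 ⟨hsub L hL, hleaf_ne L hL⟩)
    have hKC : disjointWeight q α center < disjointWeight q α K := by
      rw [hdC, hdleaf K hK]; linarith [hpos L hL]
    have hex := fun {A B : Finset (Fin q)} (hA : A ∈ supp q α) (hB : B.Nonempty) =>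
      hα.exchange (hl hK) hc hA hB hKC
    set μ := (Real.log center.card - Real.log K.card) /
      (disjointWeight q α K - disjointWeight q α center) with hμ
    have hKpos : (0 : ℝ) < K.card := by exact_mod_cast (hnonempty K hK).card_pos
    have hLpos : (0 : ℝ) < L.card := by exact_mod_cast (hnonempty L hL).card_pos
    have hμpos : 0 < μ := div_pos
      (sub_pos.2 (Real.log_lt_log hKpos (by exact_mod_cast hKlt))) (sub_pos.2 hKC)
    have heq : ∀ A ∈ leaves, Real.log center.card - Real.log A.card = μ * (X - α A) := by
      intro A hA
      have g1 := hex hc (hnonempty A hA)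
      have g2 := hex (hl hA) (mem_supp.1 hc).1
      rw [hdC, hdleaf A hA] at g1 g2
      linarith
    have hu := hex hc ((hnonempty K hK).mono (Finset.subset_union_left (s₂ := L)))
    have hd := hex hc ((hnonempty M hM).mono hMsub)
    rw [hdC, hdunion, Finset.card_union_of_disjoint (hleaves_disj K hK L hL hKL),
      Nat.cast_add] at hu
    rw [hdC, hdsdiff, Finset.card_sdiff_of_subset (hsub L hL), Nat.cast_sub hLlt.le] at hd
    exact star_optimality_false hKpos hLpos (by exact_mod_cast hLlt) hμpos hXlt
      (heq K hK) (heq L hL) (by linarith) (by linarith)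
  have hcard : leaves.card = 2 := by
    have := hne.card_pos
    omega
  refine ⟨hcard, ((supp q α).erase center).card, (supp q α).erase center, ?_⟩
  obtain ⟨K, L, hKL, hleaves⟩ := Finset.card_eq_two.1 hcard
  have hK : K ∈ leaves := by simp [hleaves]
  have hL : L ∈ leaves := by simp [hleaves]
  have hunion : K ∪ L = center := by
    refine Finset.Subset.antisymm (Finset.union_subset (hsub K hK) (hsub L hL)) fun x hx => ?_
    obtain ⟨D, hD, hxD⟩ := hcenter x hx
    rw [hleaves, Finset.mem_insert, Finset.mem_singleton] at hD
    rcases hD with rfl | rfl <;> simp [hxD]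
  refine ⟨K, Finset.mem_erase.2 ⟨hleaf_ne K hK, hl hK⟩,
    L, Finset.mem_erase.2 ⟨hleaf_ne L hL, hl hL⟩, hKL, ⟨?_, ?_, ?_⟩, rfl, ?_⟩
  · exact fun A hA => (mem_supp.1 (Finset.mem_of_mem_erase hA)).1
  · intro A hA B hB hAB
    rw [Finset.mem_erase] at hA hB
    exact hdisj A hA.2 B hB.2 hAB hA.1 hB.1
  · refine Finset.eq_univ_of_forall fun x => Finset.mem_biUnion.2 ?_
    obtain ⟨D, hD, hxD⟩ := hcover x
    by_cases hDc : D = center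
    · obtain ⟨A, hA, hxA⟩ := hcenter x (hDc ▸ hxD)
      exact ⟨A, Finset.mem_erase.2 ⟨hleaf_ne A hA, hl hA⟩, hxA⟩
    · exact ⟨D, Finset.mem_erase.2 ⟨hDc, hD⟩, hxD⟩
  · rw [hunion, Finset.insert_erase hc]
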